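/- arXiv:2511.04836 — 2 statements merged into one kernel-verified Lean document; each statement's English description precedes it below -/
import Mathlib

section
/- Fix s ≠ t in S, write m := m_{s,t} and x := x_m ∈ R_M. Then for every integer k ≥ 1: (σ_sσ_t)^k(α_s) = Δ_{2k}(x)·α_s + Δ_{2k−1}(x)·α_t and (σ_sσ_t)^k(α_t) = −Δ_{2k−1}(x)·α_s − Δ_{2k−2}(x)·α_t in R_MΛ_S (here (σ_sσ_t)^k means k-fold application of the composite 'σ_t first, then σ_s', and Δ_j(x) is the image in R_M of the j-th Chebyshev polynomial evaluated at x). -/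
open scoped BigOperators

noncomputable section

/-- The normalized Chebyshev polynomials `Δ_k(x) ∈ ℤ[x]`:
`Δ_0 = 1`, `Δ_1 = x`, `Δ_{k+1} = x·Δ_k − Δ_{k−1}`. -/
def cheb : ℕ → Polynomial ℤ
  | 0 => 1
  | 1 => Polynomial.X
  | (k + 2) => Polynomial.X * cheb (k + 1) - cheb k

/-- The defining relation attached to the label `m`: `Δ_{m−1}(x_m)` for finite `m`, and
`x_∞ − 2` for `m = ∞` (recall that in a `CoxeterMatrix` the label `0` denotes `∞`). -/
def relPoly (m : ℕ) : MvPolynomial ℕ ℤ :=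
  if m = 0 then MvPolynomial.X 0 - 2
  else Polynomial.aeval (MvPolynomial.X m) (cheb (m - 1))

/-- The set `M` of labels `m_{s,t}`, `s ≠ t`, of the Coxeter matrix. -/
def labelSet {S : Type*} (M : CoxeterMatrix S) : Set ℕ :=
  {m | ∃ s t : S, s ≠ t ∧ M s t = m}

/-- The type-`A` fusion ring `R_M = ℤ[x_m : m ∈ M] / ⟨Δ_{m−1}(x_m), m ∈ M⟩` associated to
a Coxeter matrix. -/
abbrev RM {S : Type*} (M : CoxeterMatrix S) : Type _ :=
  MvPolynomial ℕ ℤ ⧸ Ideal.span (relPoly '' labelSet M)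

/-- The image `x_m ∈ R_M` of the variable attached to the label `m`. -/
def xvar {S : Type*} (M : CoxeterMatrix S) (m : ℕ) : RM M :=
  Ideal.Quotient.mk _ (MvPolynomial.X m)

/-- The basis vector `α_s` of `R_MΛ_S = S → R_M`. -/
def alphaRM {S : Type*} [DecidableEq S] (M : CoxeterMatrix S) (s : S) : S → RM M :=
  Pi.single s 1

/-- The Cartan matrix of the geometric `R_M`-realisation: `r_{s,s} = 2`,
`r_{s,t} = −x_{m_{s,t}}` for `s ≠ t`. -/
def cartRM {S : Type*} [DecidableEq S] (M : CoxeterMatrix S) (s t : S) : RM M :=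
  if s = t then 2 else -(xvar M (M s t))

/-- The reflection `σ_s(v) = v − B(α_s, v)·α_s` on `R_MΛ_S = S → R_M`. -/
def sigmaRM {S : Type*} [Fintype S] [DecidableEq S] (M : CoxeterMatrix S) (s : S)
    (v : S → RM M) : S → RM M :=
  v - (∑ t, v t * cartRM M s t) • alphaRM M s

theorem sigma_aux {S : Type*} [Fintype S] [DecidableEq S] (M : CoxeterMatrix S)
    (s t : S) (hst : s ≠ t) (a b : RM M) :
    sigmaRM M s (a • alphaRM M s + b • alphaRM M t)
      = (xvar M (M s t) * b - a) • alphaRM M s + b • alphaRM M t := by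
  have h : (∑ u, (a • alphaRM M s + b • alphaRM M t) u * cartRM M s u)
      = 2 * a - xvar M (M s t) * b := by
    simp only [alphaRM, Pi.add_apply, Pi.smul_apply, smul_eq_mul, add_mul,
      Finset.sum_add_distrib, Pi.single_apply, mul_ite, ite_mul, mul_one, mul_zero, zero_mul,
      Finset.sum_ite_eq', Finset.mem_univ, if_true]
    simp only [cartRM, if_true, if_neg hst]
    ring
  rw [sigmaRM, h]
  module

theorem sigma_aux2 {S : Type*} [Fintype S] [DecidableEq S] (M : CoxeterMatrix S)
    (s t : S) (hst : s ≠ t) (a b : RM M) :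
    (sigmaRM M s ∘ sigmaRM M t) (a • alphaRM M s + b • alphaRM M t)
      = (xvar M (M s t) * (xvar M (M s t) * a - b) - a) • alphaRM M s
        + (xvar M (M s t) * a - b) • alphaRM M t := by
  rw [Function.comp_apply, add_comm, sigma_aux M t s hst.symm, add_comm, sigma_aux M s t hst,
    M.symmetric t s]

theorem cheb_aux {R : Type*} [CommRing R] [Algebra ℤ R] (x : R) (n : ℕ) :
    Polynomial.aeval x (cheb (n + 2))
      = x * Polynomial.aeval x (cheb (n + 1)) - Polynomial.aeval x (cheb n) := by
  rw [cheb, map_sub, map_mul, Polynomial.aeval_X]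

/-- **Equation (3.2).** For `s ≠ t`, `m := m_{s,t}`, `x := x_m`, and `k ≥ 1`:
`(σ_sσ_t)^k(α_s) = Δ_{2k}(x)·α_s + Δ_{2k−1}(x)·α_t` and
`(σ_sσ_t)^k(α_t) = −Δ_{2k−1}(x)·α_s − Δ_{2k−2}(x)·α_t`. -/
theorem sigma_pow_apply {S : Type*} [Fintype S] [DecidableEq S] (M : CoxeterMatrix S)
    (s t : S) (hst : s ≠ t) (k : ℕ) (hk : 1 ≤ k) :
    (sigmaRM M s ∘ sigmaRM M t)^[k] (alphaRM M s)
        = Polynomial.aeval (xvar M (M s t)) (cheb (2 * k)) • alphaRM M s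
          + Polynomial.aeval (xvar M (M s t)) (cheb (2 * k - 1)) • alphaRM M t
    ∧ (sigmaRM M s ∘ sigmaRM M t)^[k] (alphaRM M t)
        = -(Polynomial.aeval (xvar M (M s t)) (cheb (2 * k - 1)) • alphaRM M s)
          - Polynomial.aeval (xvar M (M s t)) (cheb (2 * k - 2)) • alphaRM M t := by
  obtain ⟨n, rfl⟩ : ∃ n, k = n + 1 := ⟨k - 1, by omega⟩
  clear hk
  rw [show 2 * (n + 1) - 1 = 2 * n + 1 by omega, show 2 * (n + 1) - 2 = 2 * n by omega,
    show 2 * (n + 1) = 2 * n + 2 by omega]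
  induction n with
  | zero =>
    have e1 : alphaRM M s = (1 : RM M) • alphaRM M s + (0 : RM M) • alphaRM M t := by module
    have e2 : alphaRM M t = (0 : RM M) • alphaRM M s + (1 : RM M) • alphaRM M t := by module
    have h1 := sigma_aux2 M s t hst 1 0
    have h2 := sigma_aux2 M s t hst 0 1
    rw [← e1] at h1
    rw [← e2] at h2
    rw [Nat.mul_zero, Nat.zero_add, Nat.zero_add, Function.iterate_one, h1, h2]
    simp only [cheb, Polynomial.aeval_X, map_one, map_sub, map_mul]
    constructor <;> module
  | succ n ih =>
    obtain ⟨h1, h2⟩ := ih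
    rw [Function.iterate_succ_apply' _ (n + 1), Function.iterate_succ_apply' _ (n + 1), h1, h2,
      show 2 * (n + 1) = 2 * n + 2 by omega]
    have e : ∀ a b : RM M, -(a • alphaRM M s) - b • alphaRM M t
        = (-a) • alphaRM M s + (-b) • alphaRM M t := by
      intro a b
      module
    rw [e, e, sigma_aux2 M s t hst, sigma_aux2 M s t hst]
    rw [cheb_aux _ (2 * n + 2), cheb_aux _ (2 * n + 1), cheb_aux _ (2 * n)]
    constructor <;> module

end
end

section
/- Each σ_s is an involution (σ_s∘σ_s = id on R_MΛ_S), and for all s ≠ t in S with m_{s,t} < ∞ one has (σ_sσ_t)^{m_{s,t}} = id on R_MΛ_S. Consequently there is a group homomorphism from the Coxeter group W to the group of R_M-linear automorphisms of R_MΛ_S sending each s ∈ S to σ_s; i.e., R_MΛ_S equipped with B is a realisation of (W,S) over R_M. -/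
open scoped BigOperators

noncomputable section

theorem aux_iter {R V : Type*} [CommRing R] [AddCommGroup V] [Module R V]
    (f g : V →ₗ[R] R) (a b : V) (x : R) (fa : f a = 2) (gb : g b = 2) (fb : f b = -x)
    (ga : g a = -x) (S T : V → V) (hS : ∀ v, S v = v - f v • a) (hT : ∀ v, T v = v - g v • b)
    (u : ℕ → R) (u0 : u 0 = 0) (u1 : u 1 = 1) (hu : ∀ k, u (k + 2) = x * u (k + 1) - u k)
    (k : ℕ) (v : V) :
    (u (k + 1) ^ 2 + u k ^ 2 - x * u (k + 1) * u k = 1) ∧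
    (S ∘ T)^[k] v = v - (u k * (f v * u k + g v * u (k + 1))) • a
      - (u k * (f v * (x * u k - u (k + 1)) + g v * u k)) • b := by
  induction k with
  | zero => simp [u0, u1]
  | succ k ih =>
    obtain ⟨h1, h2⟩ := ih
    refine ⟨by rw [hu]; linear_combination h1, ?_⟩
    rw [Function.iterate_succ_apply', h2, Function.comp_apply, hT, hS, hu]
    simp only [map_sub, map_smul, fa, ga, fb, gb, smul_eq_mul]
    generalize f v = p at *
    generalize g v = q at *
    generalize u k = c at *
    generalize u (k + 1) = e at *
    match_scalars
    · ring
    · linear_combination (p + q * x) * h1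
    · linear_combination q * h1

theorem rel_zero {S : Type*} (M : CoxeterMatrix S) (s t : S) (h : s ≠ t) (h0 : M s t ≠ 0) :
    Polynomial.aeval (xvar M (M s t)) (cheb (M s t - 1)) = 0 := by
  have h1 : relPoly (M s t) ∈ Ideal.span (relPoly '' labelSet M) :=
    Ideal.subset_span ⟨_, ⟨s, t, h, rfl⟩, rfl⟩
  have h2 := Ideal.Quotient.eq_zero_iff_mem.2 h1
  rw [relPoly, if_neg h0] at h2
  rw [← h2, xvar]
  exact Polynomial.aeval_algHom_apply
    ((Ideal.Quotient.mk (Ideal.span (relPoly '' labelSet M))).toIntAlgHom) _ _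

def fRM {S : Type*} [Fintype S] [DecidableEq S] (M : CoxeterMatrix S) (s : S) :
    (S → RM M) →ₗ[RM M] RM M where
  toFun v := ∑ t, v t * cartRM M s t
  map_add' v w := by simp [add_mul, Finset.sum_add_distrib]
  map_smul' c v := by simp [Finset.mul_sum, mul_assoc]

theorem fRM_alpha {S : Type*} [Fintype S] [DecidableEq S] (M : CoxeterMatrix S) (s t : S) :
    fRM M s (alphaRM M t) = cartRM M s t := by
  simp [fRM, alphaRM, Pi.single_apply]

theorem sigma_eq {S : Type*} [Fintype S] [DecidableEq S] (M : CoxeterMatrix S) (s : S)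
    (v : S → RM M) : sigmaRM M s v = v - fRM M s v • alphaRM M s := rfl

theorem sigma_invol {S : Type*} [Fintype S] [DecidableEq S] (M : CoxeterMatrix S) (s : S)
    (v : S → RM M) : sigmaRM M s (sigmaRM M s v) = v := by
  rw [sigma_eq M s (sigmaRM M s v), sigma_eq, map_sub, map_smul, fRM_alpha]
  simp only [cartRM, if_true, smul_eq_mul]
  match_scalars <;> ring

def uSeq {R : Type*} [CommRing R] (x : R) : ℕ → R
  | 0 => 0
  | (k + 1) => Polynomial.aeval x (cheb k)

theorem sigma_pow {S : Type*} [Fintype S] [DecidableEq S] (M : CoxeterMatrix S) (s t : S)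
    (h : s ≠ t) (h0 : M s t ≠ 0) : (sigmaRM M s ∘ sigmaRM M t)^[M s t] = id := by
  funext v
  have hz : uSeq (xvar M (M s t)) (M s t) = 0 := by
    have := rel_zero M s t h h0
    obtain ⟨n, hn⟩ := Nat.exists_eq_succ_of_ne_zero h0
    rw [hn] at this ⊢
    exact this
  have := (aux_iter (fRM M s) (fRM M t) (alphaRM M s) (alphaRM M t) (xvar M (M s t))
    (by simp [fRM_alpha, cartRM]) (by simp [fRM_alpha, cartRM])
    (by simp [fRM_alpha, cartRM, h]) (by simp [fRM_alpha, cartRM, h.symm, M.symmetric t s])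
    (sigmaRM M s) (sigmaRM M t) (sigma_eq M s) (sigma_eq M t) (uSeq (xvar M (M s t)))
    rfl (by simp [uSeq, cheb])
    (by rintro (_ | k) <;> simp [uSeq, cheb]) (M s t) v).2
  rw [this, hz]
  simp

def sigmaEquiv {S : Type*} [Fintype S] [DecidableEq S] (M : CoxeterMatrix S) (s : S) :
    (S → RM M) ≃ₗ[RM M] (S → RM M) :=
  LinearEquiv.ofInvolutive
    { toFun := sigmaRM M s
      map_add' := fun v w => by
        simp only [sigma_eq, map_add, add_smul]
        abel
      map_smul' := fun c v => by
        simp only [sigma_eq, map_smul, smul_sub, smul_assoc, RingHom.id_apply] }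
    (sigma_invol M s)

theorem sigmaEquiv_apply {S : Type*} [Fintype S] [DecidableEq S] (M : CoxeterMatrix S) (s : S)
    (v : S → RM M) : sigmaEquiv M s v = sigmaRM M s v := rfl

theorem sigma_liftable {S : Type*} [Fintype S] [DecidableEq S] (M : CoxeterMatrix S) :
    M.IsLiftable (sigmaEquiv M) := by
  intro s t
  by_cases h : s = t
  · subst h
    ext1 v
    rw [M.diagonal, pow_one]
    exact sigma_invol M s v
  by_cases h0 : M s t = 0
  · rw [h0, pow_zero]
  have key : ∀ (n : ℕ) (v : S → RM M), ((sigmaEquiv M s * sigmaEquiv M t) ^ n) v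
      = (sigmaRM M s ∘ sigmaRM M t)^[n] v := by
    intro n
    induction n with
    | zero => intro v; rfl
    | succ n ih =>
      intro v
      rw [pow_succ, Function.iterate_succ_apply, ← ih]
      rfl
  apply LinearEquiv.ext
  intro v
  rw [key, sigma_pow M s t h h0]
  rfl

/-- **Proposition 3.10 (cf. Theorem 3.6).** Each `σ_s` is an involution, for `s ≠ t` with
`m_{s,t} < ∞` one has `(σ_sσ_t)^{m_{s,t}} = id`, and consequently `W` acts `R_M`-linearly
on `R_MΛ_S` by `s ↦ σ_s`; i.e. `R_MΛ_S` is a realisation of `(W, S)` over `R_M`. -/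
theorem RM_realisation {S : Type*} [Fintype S] [DecidableEq S] {W : Type*} [Group W]
    (M : CoxeterMatrix S) (cs : CoxeterSystem M W) :
    (∀ s : S, sigmaRM M s ∘ sigmaRM M s = id)
    ∧ (∀ s t : S, s ≠ t → M s t ≠ 0 → (sigmaRM M s ∘ sigmaRM M t)^[M s t] = id)
    ∧ ∃ ρ : W →* ((S → RM M) ≃ₗ[RM M] (S → RM M)),
        ∀ (s : S) (v : S → RM M), ρ (cs.simple s) v = sigmaRM M s v := by
  refine ⟨fun s => funext (sigma_invol M s), sigma_pow M,
    cs.lift ⟨sigmaEquiv M, sigma_liftable M⟩, fun s v => ?_⟩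
  rw [cs.lift_apply_simple (sigma_liftable M)]
  rfl

end
end
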